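/- Assume n ≥ 2. If there exists a nonzero a ∈ A with 2·a = 0 and (algebraMap A A_f a)·D_f = 0, then there exists an S_n-invariant element of A_f that is not a trivial S_n-invariant. -/

import Mathlib

open MvPolynomial

noncomputable section

/-- The ideal defining the splitting algebra of `f = Xⁿ + a₁Xⁿ⁻¹ + ⋯ + aₙ`. -/
def splittingIdeal (A : Type*) [CommRing A] (n : ℕ) (a : Fin n → A) :
    Ideal (MvPolynomial (Fin n) A) :=
  Ideal.span (Set.range fun k : Fin n =>
    esymm (Fin n) A (k.1 + 1) - C ((-1 : A) ^ (k.1 + 1) * a k))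

/-- The splitting algebra `A_f`. -/
abbrev SplittingAlg (A : Type*) [CommRing A] (n : ℕ) (a : Fin n → A) : Type _ :=
  MvPolynomial (Fin n) A ⧸ splittingIdeal A n a

/-- The quotient map `π`. -/
def splittingMk (A : Type*) [CommRing A] (n : ℕ) (a : Fin n → A) :
    MvPolynomial (Fin n) A →ₐ[A] SplittingAlg A n a :=
  Ideal.Quotient.mkₐ A (splittingIdeal A n a)

/-- The universal roots `τᵢ`. -/
def tau (A : Type*) [CommRing A] (n : ℕ) (a : Fin n → A) (i : Fin n) :
    SplittingAlg A n a :=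
  splittingMk A n a (X i)

theorem rename_mem_splittingIdeal (A : Type*) [CommRing A] (n : ℕ) (a : Fin n → A)
    (σ : Equiv.Perm (Fin n)) {p : MvPolynomial (Fin n) A}
    (hp : p ∈ splittingIdeal A n a) :
    rename (σ : Fin n → Fin n) p ∈ splittingIdeal A n a := by
  have h : (splittingIdeal A n a).map ((rename (σ : Fin n → Fin n)).toRingHom :
      MvPolynomial (Fin n) A →+* MvPolynomial (Fin n) A) ≤ splittingIdeal A n a := by
    rw [splittingIdeal, Ideal.map_span]
    refine Ideal.span_le.2 ?_
    rintro _ ⟨_, ⟨k, rfl⟩, rfl⟩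
    have hren : (rename (σ : Fin n → Fin n))
        (esymm (Fin n) A (k.1 + 1) - C ((-1 : A) ^ (k.1 + 1) * a k))
        = esymm (Fin n) A (k.1 + 1) - C ((-1 : A) ^ (k.1 + 1) * a k) := by
      rw [map_sub, esymm_isSymmetric (Fin n) A (k.1 + 1) σ, rename_C]
    show (rename (σ : Fin n → Fin n))
        (esymm (Fin n) A (k.1 + 1) - C ((-1 : A) ^ (k.1 + 1) * a k)) ∈ _
    rw [hren]
    exact Ideal.subset_span ⟨k, rfl⟩
  exact h (Ideal.mem_map_of_mem _ hp)

/-- The action of a permutation `σ` on the splitting algebra, as an `A`-algebra map. -/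
def permHom (A : Type*) [CommRing A] (n : ℕ) (a : Fin n → A) (σ : Equiv.Perm (Fin n)) :
    SplittingAlg A n a →ₐ[A] SplittingAlg A n a :=
  Ideal.Quotient.liftₐ (splittingIdeal A n a)
    ((splittingMk A n a).comp (rename (σ : Fin n → Fin n)))
    (fun p hp => by
      have h := rename_mem_splittingIdeal A n a σ hp
      show Ideal.Quotient.mkₐ A (splittingIdeal A n a) _ = 0
      rw [Ideal.Quotient.mkₐ_eq_mk]
      exact (Ideal.Quotient.eq_zero_iff_mem).2 h)

/-- The trivial `G`-invariants of the splitting algebra. -/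
def trivialInv (A : Type*) [CommRing A] (n : ℕ) (a : Fin n → A)
    (G : Subgroup (Equiv.Perm (Fin n))) : Set (SplittingAlg A n a) :=
  splittingMk A n a '' {p | ∀ σ ∈ G, rename (σ : Fin n → Fin n) p = p}

/-- The element `D_f = ∏_{i<j} (τᵢ + τⱼ)`. -/
def Df (A : Type*) [CommRing A] (n : ℕ) (a : Fin n → A) : SplittingAlg A n a :=
  ∏ p ∈ Finset.univ.filter (fun p : Fin n × Fin n => p.1 < p.2),
    (tau A n a p.1 + tau A n a p.2)

end

/-- McCoy's theorem: if a nonzero element annihilates all maximal minors of a matrix over a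
commutative ring, then the matrix has a nonzero kernel vector. -/
theorem Matrix.exists_mulVec_eq_zero_of_mul_minors_eq_zero {A ρ κ : Type*} [CommRing A]
    [Fintype κ] (M : Matrix ρ κ A) {b : A} (hb : b ≠ 0)
    (hM : ∀ (f : Fin (Fintype.card κ) → ρ) (g : Fin (Fintype.card κ) → κ),
      b * (M.submatrix f g).det = 0) :
    ∃ x : κ → A, x ≠ 0 ∧ M.mulVec x = 0 := by
  classical
  let Q : ℕ → Prop := fun k => ∃ (f : Fin k → ρ) (g : Fin k → κ), b * (M.submatrix f g).det ≠ 0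
  have h0 : Q 0 := ⟨Fin.elim0, Fin.elim0, by simpa using hb⟩
  have hN : ¬ Q (Fintype.card κ) := by
    rintro ⟨f, g, h⟩
    exact h (hM f g)
  obtain ⟨k, hk, ⟨f, g, hfg⟩, hk'⟩ : ∃ k < Fintype.card κ, Q k ∧ ¬ Q (k + 1) := by
    by_contra! h
    have : ∀ k ≤ Fintype.card κ, Q k := by
      intro k
      induction k with
      | zero => exact fun _ => h0
      | succ k ih => exact fun hk => h k hk (ih (by omega))
    exact hN (this _ le_rfl)
  obtain ⟨j, hj⟩ : ∃ j, j ∉ Set.range g := by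
    by_contra! h
    have := Fintype.card_le_of_surjective g h
    simp at this
    omega
  let g' : Fin (k + 1) → κ := Fin.cons j g
  let c : Fin (k + 1) → A := fun i => b * ((-1) ^ (i : ℕ) * (M.submatrix f (g' ∘ i.succAbove)).det)
  refine ⟨fun l => ∑ i, if g' i = l then c i else 0, fun h => hfg ?_, ?_⟩
  · have h1 := congrFun h j
    rw [Fin.sum_univ_succ] at h1
    have h2 : ∀ i : Fin k, g i ≠ j := fun i hi => hj ⟨i, hi⟩
    simpa [g', c, h2, Function.comp_def] using h1
  · ext r
    have h1 : b * (M.submatrix (Fin.cons r f : Fin (k + 1) → ρ) g').det = 0 := by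
      by_contra h
      exact hk' ⟨_, _, h⟩
    rw [Matrix.det_succ_row_zero, Finset.mul_sum] at h1
    simp only [Matrix.mulVec, dotProduct, Finset.mul_sum, Pi.zero_apply]
    rw [Finset.sum_comm]
    refine (Finset.sum_congr rfl fun i _ => ?_).trans h1
    simp only [mul_ite, mul_zero, Finset.sum_ite_eq, Finset.mem_univ, if_true, c]
    have h3 : (M.submatrix (Fin.cons r f : Fin (k + 1) → ρ) g').submatrix Fin.succ i.succAbove
        = M.submatrix f (g' ∘ i.succAbove) := by
      ext; simp
    rw [h3]
    simp
    ring

open Polynomial in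
/-- A monic polynomial of degree `n` splits in a universal way over a finite free algebra having
a basis that contains `1`. -/
theorem Polynomial.Monic.exists_universal_splitting (n : ℕ) :
    ∀ (A : Type) [CommRing A] [Nontrivial A] (f : A[X]), f.Monic → f.natDegree = n →
    ∃ (B : Type) (_ : CommRing B) (_ : Algebra A B) (ι : Type) (_ : Fintype ι) (i₀ : ι)
      (e : Module.Basis ι A B) (t : Fin n → B), e i₀ = 1 ∧
      f.map (algebraMap A B) = ∏ i, (X - C (t i)) ∧
      Algebra.adjoin A (Set.range t) = ⊤ ∧
      ∀ (S : Type) [CommRing S] (j : A →+* S) (s : Fin n → S), f.map j = ∏ i, (X - C (s i)) →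
        ∃ φ : B →+* S, φ.comp (algebraMap A B) = j ∧ ∀ i, φ (t i) = s i := by
  induction n with
  | zero =>
    intro A _ _ f hf hn
    refine ⟨A, inferInstance, inferInstance, Unit, inferInstance, (), Module.Basis.singleton Unit A,
      Fin.elim0, by simp, ?_, ?_, ?_⟩
    · rw [hf.natDegree_eq_zero.1 hn]; simp
    · rw [eq_top_iff]
      rintro x -
      exact Subalgebra.algebraMap_mem _ x
    · intro S _ j s _
      exact ⟨j, by ext; simp, fun i => i.elim0⟩
  | succ n ih =>
    intro A _ _ f hf hn
    let A' := AdjoinRoot f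
    let pb := AdjoinRoot.powerBasis' hf
    have hdim : pb.dim = n + 1 := hn
    let k₀ : Fin pb.dim := ⟨0, by omega⟩
    have hk₀ : pb.basis k₀ = 1 := by simp [k₀]
    have : Nontrivial A' := by
      refine ⟨⟨pb.basis k₀, 0, pb.basis.ne_zero k₀⟩⟩
    let r : A' := AdjoinRoot.root f
    have hroot : (f.map (algebraMap A A')).IsRoot r := by
      rw [IsRoot.def, eval_map]
      exact AdjoinRoot.eval₂_root f
    let g : A'[X] := f.map (algebraMap A A') /ₘ (X - C r)
    have hg : (X - C r) * g = f.map (algebraMap A A') := mul_divByMonic_eq_iff_isRoot.2 hroot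
    have hgm : g.Monic := by
      have h1 := hf.map (algebraMap A A')
      rw [← hg] at h1
      exact (monic_X_sub_C r).of_mul_monic_left h1
    have hgn : g.natDegree = n := by
      have h1 := congrArg natDegree hg
      rw [(monic_X_sub_C r).natDegree_mul hgm, hf.natDegree_map, natDegree_X_sub_C] at h1
      omega
    obtain ⟨B, _, _, ι, _, i₀, e, t, he, hgt, hadj, huniv⟩ := ih A' g hgm hgn
    let _ : Algebra A B := ((algebraMap A' B).comp (algebraMap A A')).toAlgebra
    have : IsScalarTower A A' B := IsScalarTower.of_algebraMap_eq fun _ => rfl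
    refine ⟨B, inferInstance, inferInstance, Fin pb.dim × ι, inferInstance, (k₀, i₀),
      pb.basis.smulTower e, Fin.cons (algebraMap A' B r) t, ?_, ?_, ?_, ?_⟩
    · rw [Module.Basis.smulTower_apply, hk₀, he, one_smul]
    · rw [IsScalarTower.algebraMap_eq A A' B, ← Polynomial.map_map, ← hg, Polynomial.map_mul, hgt,
        Fin.prod_univ_succ]
      simp
    · have hA' : Algebra.adjoin A {r} = ⊤ := AdjoinRoot.adjoinRoot_eq_top
      have h1 : ∀ x : A', algebraMap A' B x ∈
          Algebra.adjoin A (Set.range (Fin.cons (algebraMap A' B r) t : Fin (n + 1) → B)) := by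
        intro x
        have hx : x ∈ Algebra.adjoin A {r} := hA' ▸ Algebra.mem_top
        induction hx using Algebra.adjoin_induction with
        | mem x hx =>
          rw [Set.mem_singleton_iff.1 hx]
          exact Algebra.subset_adjoin ⟨0, by simp⟩
        | algebraMap a =>
          rw [← IsScalarTower.algebraMap_apply]
          exact Subalgebra.algebraMap_mem _ a
        | add x y _ _ hx hy => rw [map_add]; exact add_mem hx hy
        | mul x y _ _ hx hy => rw [map_mul]; exact mul_mem hx hy
      rw [eq_top_iff]
      rintro x -
      have hx : x ∈ Algebra.adjoin A' (Set.range t) := hadj ▸ Algebra.mem_top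
      induction hx using Algebra.adjoin_induction with
      | mem x hx =>
        obtain ⟨i, rfl⟩ := hx
        exact Algebra.subset_adjoin ⟨i.succ, by simp⟩
      | algebraMap a => exact h1 a
      | add x y _ _ hx hy => exact add_mem hx hy
      | mul x y _ _ hx hy => exact mul_mem hx hy
    · intro S _ j s hs
      have hs0 : f.eval₂ j (s 0) = 0 := by
        rw [← eval_map, hs, eval_prod]
        exact Finset.prod_eq_zero (Finset.mem_univ 0) (by simp)
      let j' : A' →+* S := AdjoinRoot.lift j (s 0) hs0
      have hj' : j'.comp (algebraMap A A') = j := by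
        ext x; simp [j', A']
      have hr : j' r = s 0 := AdjoinRoot.lift_root hs0
      obtain ⟨φ, hφ, hφt⟩ := huniv S j' (fun i => s i.succ) (by
        have h1 := congrArg (Polynomial.map j') hg
        rw [Polynomial.map_map, hj', hs, Polynomial.map_mul, Fin.prod_univ_succ] at h1
        simp only [Polynomial.map_sub, map_X, map_C, hr] at h1
        exact (monic_X_sub_C (s 0)).isRegular.left h1)
      refine ⟨φ, ?_, ?_⟩
      · rw [IsScalarTower.algebraMap_eq A A' B, ← RingHom.comp_assoc, hφ, hj']
      · intro i
        refine Fin.cases ?_ (fun i => ?_) i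
        · rw [Fin.cons_zero, ← hr, ← hφ]; rfl
        · rw [Fin.cons_succ, hφt]

/-- The product of all `X i + X j` with `i < j`. -/
noncomputable def pairSumProd (R : Type*) [CommRing R] (n : ℕ) : MvPolynomial (Fin n) R :=
  ∏ p ∈ Finset.univ.filter (fun p : Fin n × Fin n => p.1 < p.2), (X p.1 + X p.2)

theorem Matrix.det_vandermonde_eq_prod_filter {R : Type*} [CommRing R] {n : ℕ} (v : Fin n → R) :
    (Matrix.vandermonde v).det =
      ∏ p ∈ Finset.univ.filter (fun p : Fin n × Fin n => p.1 < p.2), (v p.2 - v p.1) := by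
  rw [Matrix.det_vandermonde, Finset.prod_filter, ← Finset.univ_product_univ, Finset.prod_product]
  refine Finset.prod_congr rfl fun i _ => ?_
  rw [← Finset.prod_filter]
  refine Finset.prod_congr ?_ fun _ _ => rfl
  ext j; simp

theorem rename_det_vandermonde {R : Type*} [CommRing R] {n : ℕ} (k : ℕ)
    (σ : Equiv.Perm (Fin n)) :
    rename σ (Matrix.vandermonde fun i => (X i : MvPolynomial (Fin n) R) ^ k).det =
      (Equiv.Perm.sign σ : MvPolynomial (Fin n) R) *
        (Matrix.vandermonde fun i => (X i : MvPolynomial (Fin n) R) ^ k).det := by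
  rw [← Matrix.det_permute, AlgHom.map_det]
  congr 1
  ext1 i j
  simp [Matrix.vandermonde]

theorem rename_pairSumProd (n : ℕ) (σ : Equiv.Perm (Fin n)) :
    rename σ (pairSumProd ℤ n) = pairSumProd ℤ n := by
  let V : ℕ → MvPolynomial (Fin n) ℤ := fun k => (Matrix.vandermonde fun i => X i ^ k).det
  have hV : V 2 = V 1 * pairSumProd ℤ n := by
    simp only [V, Matrix.det_vandermonde_eq_prod_filter, pairSumProd, ← Finset.prod_mul_distrib]
    exact Finset.prod_congr rfl fun _ _ => by ring
  have hV1 : V 1 ≠ 0 := by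
    rw [Matrix.det_vandermonde_ne_zero_iff]
    intro i j h
    simpa using h
  have hr : ∀ k, rename σ (V k) = (Equiv.Perm.sign σ : MvPolynomial (Fin n) ℤ) * V k :=
    fun k => rename_det_vandermonde k σ
  have h1 := hr 2
  rw [hV, map_mul, hr 1, mul_assoc] at h1
  have hs : (Equiv.Perm.sign σ : MvPolynomial (Fin n) ℤ) ≠ 0 := by
    rcases Int.units_eq_one_or (Equiv.Perm.sign σ) with h | h <;> simp [h]
  exact mul_left_cancel₀ hV1 (mul_left_cancel₀ hs h1)

theorem map_pairSumProd {R S : Type*} [CommRing R] [CommRing S] (f : R →+* S) (n : ℕ) :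
    map f (pairSumProd R n) = pairSumProd S n := by
  simp [pairSumProd]

theorem map_det_vandermonde_eq_pairSumProd (n : ℕ) :
    map (Int.castRingHom (ZMod 2))
      (Matrix.vandermonde fun i => (X i : MvPolynomial (Fin n) ℤ)).det =
      pairSumProd (ZMod 2) n := by
  rw [Matrix.det_vandermonde_eq_prod_filter, pairSumProd, map_prod]
  refine Finset.prod_congr rfl fun p _ => ?_
  simp [CharTwo.sub_eq_add, add_comm]

/-- The sum of the orbit of `∏ i, X i ^ i` under the alternating group. -/
noncomputable def altOrbitSum (n : ℕ) : MvPolynomial (Fin n) ℤ :=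
  ∑ τ : Equiv.Perm (Fin n),
    if Equiv.Perm.sign τ = 1 then rename τ (∏ i : Fin n, X i ^ (i : ℕ)) else 0

theorem rename_altOrbitSum (n : ℕ) (σ : Equiv.Perm (Fin n)) :
    rename σ (altOrbitSum n) = ∑ τ : Equiv.Perm (Fin n),
      if Equiv.Perm.sign τ = Equiv.Perm.sign σ then
        rename τ (∏ i : Fin n, X i ^ (i : ℕ)) else 0 := by
  rw [altOrbitSum, map_sum]
  refine Fintype.sum_equiv (Equiv.mulLeft σ) _ _ fun τ => ?_
  simp only [Equiv.coe_mulLeft, Equiv.Perm.sign_mul, mul_eq_left]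
  split_ifs
  · rw [rename_rename]; rfl
  · simp

theorem rename_altOrbitSum_of_sign_eq_one {n : ℕ} {σ : Equiv.Perm (Fin n)}
    (h : Equiv.Perm.sign σ = 1) : rename σ (altOrbitSum n) = altOrbitSum n := by
  rw [rename_altOrbitSum, h, altOrbitSum]

theorem rename_altOrbitSum_of_sign_eq_neg_one {n : ℕ} {σ : Equiv.Perm (Fin n)}
    (h : Equiv.Perm.sign σ = -1) : rename σ (altOrbitSum n) =
      altOrbitSum n - (Matrix.vandermonde fun i => (X i : MvPolynomial (Fin n) ℤ)).det := by
  rw [rename_altOrbitSum, h, eq_sub_iff_add_eq', ← eq_sub_iff_add_eq, altOrbitSum,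
    ← Finset.sum_sub_distrib, Matrix.det_apply]
  refine Finset.sum_congr rfl fun τ _ => ?_
  rcases Int.units_eq_one_or (Equiv.Perm.sign τ) with h | h <;>
    simp [h, Matrix.vandermonde, Units.smul_def]

theorem X_add_X_dvd_rename_swap_add {n : ℕ} (i j : Fin n) (q : MvPolynomial (Fin n) (ZMod 2)) :
    X i + X j ∣ rename (Equiv.swap i j) q + q := by
  let I : Ideal (MvPolynomial (Fin n) (ZMod 2)) := Ideal.span {X i + X j}
  have h : (Ideal.Quotient.mkₐ (ZMod 2) I).comp (rename (Equiv.swap i j)) =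
      Ideal.Quotient.mkₐ (ZMod 2) I := by
    ext k
    simp only [AlgHom.comp_apply, rename_X, Ideal.Quotient.mkₐ_eq_mk]
    rw [Ideal.Quotient.eq, Ideal.mem_span_singleton, CharTwo.sub_eq_add]
    rcases eq_or_ne k i with rfl | hki
    · rw [Equiv.swap_apply_left, add_comm]
    rcases eq_or_ne k j with rfl | hkj
    · rw [Equiv.swap_apply_right]
    · rw [Equiv.swap_apply_of_ne_of_ne hki hkj, CharTwo.add_self_eq_zero]
      exact dvd_zero _
  rw [← CharTwo.sub_eq_add (rename _ q), ← Ideal.mem_span_singleton, ← Ideal.Quotient.eq]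
  exact DFunLike.congr_fun h q

theorem X_add_X_ne_zero {R : Type*} [CommRing R] [Nontrivial R] {n : ℕ} {i j : Fin n}
    (h : i ≠ j) : (X i + X j : MvPolynomial (Fin n) R) ≠ 0 := by
  intro h0
  have := congrArg (aeval fun k => if k = i then (1 : R) else 0) h0
  simp [h.symm] at this

theorem prime_X_add_X {R : Type*} [CommRing R] [IsDomain R] {n : ℕ} {i j : Fin n}
    (h : i ≠ j) : Prime (X i + X j : MvPolynomial (Fin n) R) := by
  let φ : MvPolynomial (Fin n) R →ₐ[R] MvPolynomial (Fin n) R :=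
    aeval fun k => if k = i then X i + X j else X k
  let ψ : MvPolynomial (Fin n) R →ₐ[R] MvPolynomial (Fin n) R :=
    aeval fun k => if k = i then X i - X j else X k
  have h1 : φ.comp ψ = AlgHom.id R _ := by
    ext1 k
    by_cases hk : k = i <;> simp [φ, ψ, hk, h.symm]
  have h2 : ψ.comp φ = AlgHom.id R _ := by
    ext1 k
    by_cases hk : k = i <;> simp [φ, ψ, hk, h.symm]
  have h3 : (X i + X j : MvPolynomial (Fin n) R) = AlgEquiv.ofAlgHom φ ψ h1 h2 (X i) := by
    simp [φ]
  rw [h3, MulEquiv.prime_iff]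
  exact X_prime

theorem pairSumProd_dvd {n : ℕ} {m : MvPolynomial (Fin n) (ZMod 2)}
    (h : ∀ i j, i < j → X i + X j ∣ m) : pairSumProd (ZMod 2) n ∣ m := by
  refine Finset.prod_dvd_of_isRelPrime ?_ fun p hp => h _ _ (Finset.mem_filter.1 hp).2
  intro p hp q hq hpq
  have hp' : p.1 < p.2 := (Finset.mem_filter.1 hp).2
  have hq' : q.1 < q.2 := (Finset.mem_filter.1 hq).2
  refine ((prime_X_add_X hp'.ne).irreducible.isRelPrime_iff_not_dvd).2 fun hd => hpq ?_
  have h1 := map_dvd (aeval (R := ZMod 2) fun k => if k = p.1 then X p.2 else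
    (X k : MvPolynomial (Fin n) (ZMod 2))) hd
  simp only [map_add, aeval_X, if_true, if_neg hp'.ne', CharTwo.add_self_eq_zero,
    zero_dvd_iff] at h1
  by_contra hne
  split_ifs at h1 with h2 h3 h3
  · omega
  · exact X_add_X_ne_zero (by rintro h4; exact hne (Prod.ext h2.symm h4)) h1
  · exact X_add_X_ne_zero (by rintro h4; omega) h1
  · exact X_add_X_ne_zero hq'.ne h1

theorem pairSumProd_ne_zero (n : ℕ) : pairSumProd (ZMod 2) n ≠ 0 :=
  Finset.prod_ne_zero_iff.2 fun _ hp => X_add_X_ne_zero (Finset.mem_filter.1 hp).2.ne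

theorem exists_isSymmetric_map_eq {n : ℕ} {h : MvPolynomial (Fin n) (ZMod 2)}
    (hh : h.IsSymmetric) :
    ∃ h' : MvPolynomial (Fin n) ℤ, h'.IsSymmetric ∧ map (Int.castRingHom (ZMod 2)) h' = h := by
  obtain ⟨q, hq⟩ := esymmAlgHom_surjective (σ := Fin n) (ZMod 2) (Fintype.card_fin n).le ⟨h, hh⟩
  obtain ⟨q', rfl⟩ := map_surjective (Int.castRingHom (ZMod 2)) (ZMod.intCast_surjective) q
  refine ⟨esymmAlgHom (Fin n) ℤ n q', (esymmAlgHom (Fin n) ℤ n q').2, ?_⟩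
  have hq' := congrArg Subtype.val hq
  rw [esymmAlgHom_apply] at hq' ⊢
  change _ = h at hq'
  rw [← hq', map_aeval, aeval_def, eval₂_map]
  simp only [map_esymm, coe_eval₂Hom]
  congr 1
  exact RingHom.ext_int _ _

theorem two_dvd_of_map_eq_zero {n : ℕ} {p : MvPolynomial (Fin n) ℤ}
    (h : map (Int.castRingHom (ZMod 2)) p = 0) : 2 ∣ p := by
  have := (C_dvd_iff_zmod (σ := Fin n) 2 p).2 h
  simpa using this

theorem exists_eq_pairSumProd_mul_add {n : ℕ} {m s q w : MvPolynomial (Fin n) ℤ}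
    (hm : m.IsSymmetric) (hs : s.IsSymmetric)
    (h : m * altOrbitSum n = s + (pairSumProd ℤ n * q + 2 * w)) :
    ∃ u v : MvPolynomial (Fin n) ℤ, u.IsSymmetric ∧ v.IsSymmetric ∧
      m = pairSumProd ℤ n * u + 2 * v := by
  let μ := map (σ := Fin n) (Int.castRingHom (ZMod 2))
  have hD := pairSumProd_ne_zero n
  have hdvd : pairSumProd (ZMod 2) n ∣ μ m := by
    refine pairSumProd_dvd fun i j hij => ?_
    have h1 := congrArg μ h
    have h3 := congrArg (fun p => μ (rename (Equiv.swap i j) p)) h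
    simp only [map_mul, map_add, hm _, hs _, rename_pairSumProd, map_ofNat,
      rename_altOrbitSum_of_sign_eq_neg_one (Equiv.Perm.sign_swap hij.ne), map_sub] at h1 h3
    simp only [μ, map_det_vandermonde_eq_pairSumProd, map_pairSumProd, map_rename,
      CharTwo.two_eq_zero, zero_mul, add_zero] at h1 h3
    have h4 : μ m = rename (Equiv.swap i j) (μ q) + μ q := by
      refine mul_left_cancel₀ hD ?_
      rw [add_comm, ← CharTwo.sub_eq_add]
      linear_combination h1 - h3
    rw [h4]
    exact X_add_X_dvd_rename_swap_add i j _
  obtain ⟨u, hu⟩ := hdvd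
  have husymm : u.IsSymmetric := by
    intro σ
    refine mul_left_cancel₀ hD ?_
    have h1 := congrArg (rename σ) hu
    rw [map_mul, ← map_pairSumProd (Int.castRingHom (ZMod 2)), ← map_rename, ← map_rename,
      rename_pairSumProd, hm σ, map_pairSumProd] at h1
    rw [← h1, ← hu]
  obtain ⟨u', hu', rfl⟩ := exists_isSymmetric_map_eq husymm
  obtain ⟨v, hv⟩ : 2 ∣ m - pairSumProd ℤ n * u' := by
    apply two_dvd_of_map_eq_zero
    rw [map_sub, map_mul, map_pairSumProd, sub_eq_zero]
    exact hu
  refine ⟨u', v, hu', fun σ => ?_, by rw [← hv]; ring⟩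
  refine mul_left_cancel₀ (two_ne_zero (α := MvPolynomial (Fin n) ℤ)) ?_
  rw [← hv]
  have h1 := congrArg (rename σ) hv
  rw [map_sub, map_mul, map_mul, hm σ, hu' σ, rename_pairSumProd, map_ofNat] at h1
  exact h1.symm

theorem Matrix.det_submatrix_mul_mem {R ρ κ : Type*} [CommRing R] [Fintype κ]
    (J : Ideal R) (M : Matrix ρ κ R) (v : κ → R) (hv : ∀ r, M.mulVec v r ∈ J)
    (f : Fin (Fintype.card κ) → ρ) (g : Fin (Fintype.card κ) → κ) (j : κ) :
    (M.submatrix f g).det * v j ∈ J := by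
  by_cases hg : Function.Injective g
  · have hb : Function.Bijective g := (Fintype.bijective_iff_injective_and_card g).2 ⟨hg, by simp⟩
    obtain ⟨i, rfl⟩ := hb.2 j
    have h1 : (M.submatrix f g).mulVec (v ∘ g) = M.mulVec v ∘ f := by
      ext r
      exact Fintype.sum_bijective g hb _ _ fun _ => rfl
    have h2 := congrFun (congrArg (M.submatrix f g).adjugate.mulVec h1) i
    rw [Matrix.mulVec_mulVec, Matrix.adjugate_mul, Matrix.smul_mulVec, Matrix.one_mulVec] at h2
    rw [Pi.smul_apply, smul_eq_mul, Function.comp_apply] at h2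
    rw [h2]
    rw [Matrix.mulVec, dotProduct]
    exact J.sum_mem fun k _ => J.mul_mem_left _ (hv _)
  · obtain ⟨k, l, hkl, hne⟩ : ∃ k l, g k = g l ∧ k ≠ l := by
      simpa [Function.Injective] using hg
    rw [Matrix.det_zero_of_column_eq hne (by simp [hkl]), zero_mul]
    exact J.zero_mem

theorem symmetricSubalgebra_ringHom_ext {n : ℕ} {S : Type*} [CommRing S]
    {f g : symmetricSubalgebra (Fin n) ℤ →+* S}
    (h : ∀ k : Fin n, f ⟨esymm (Fin n) ℤ (k + 1), esymm_isSymmetric _ _ _⟩ =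
      g ⟨esymm (Fin n) ℤ (k + 1), esymm_isSymmetric _ _ _⟩) : f = g := by
  have h1 : f.comp (esymmAlgHom (Fin n) ℤ n).toRingHom =
      g.comp (esymmAlgHom (Fin n) ℤ n).toRingHom := by
    refine MvPolynomial.ringHom_ext (fun r => ?_) fun k => ?_
    · simp
    · simpa [esymmAlgHom] using h k
  ext x
  obtain ⟨q, rfl⟩ := esymmAlgHom_surjective (σ := Fin n) ℤ (Fintype.card_fin n).le x
  exact DFunLike.congr_fun h1 q

open Polynomial in
theorem coeff_prod_X_sub_C_eq_aeval_esymm {n : ℕ} {S : Type*} [CommRing S] (s : Fin n → S)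
    {k : ℕ} (hk : k ≤ n) :
    (∏ i, (Polynomial.X - Polynomial.C (s i))).coeff (n - k) =
      (-1) ^ k * MvPolynomial.aeval s (esymm (Fin n) ℤ k) := by
  have h := Multiset.prod_X_sub_C_coeff (Finset.univ.val.map s) (k := n - k) (by simp)
  rw [Multiset.map_map, Multiset.card_map, Finset.card_val, Finset.card_fin,
    Nat.sub_sub_self hk] at h
  rw [aeval_esymm_eq_multiset_esymm, ← h]
  rfl

open Polynomial in
theorem exists_basis_symmetricSubalgebra (n : ℕ) :
    ∃ (ι : Type) (_ : Fintype ι) (i₀ : ι)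
      (e : Module.Basis ι (symmetricSubalgebra (Fin n) ℤ) (MvPolynomial (Fin n) ℤ)),
      e i₀ = 1 := by
  let Λ := symmetricSubalgebra (Fin n) ℤ
  let P := MvPolynomial (Fin n) ℤ
  let F : P[X] := ∏ i : Fin n, (Polynomial.X - Polynomial.C (MvPolynomial.X i))
  have hFm : F.Monic := monic_prod_of_monic _ _ fun i _ => monic_X_sub_C _
  have hFn : F.natDegree = n := by simp [F]
  have hFl : F ∈ Polynomial.lifts (algebraMap Λ P) := by
    rw [Polynomial.lifts_iff_coeff_lifts]
    intro k
    refine ⟨⟨F.coeff k, fun σ => ?_⟩, rfl⟩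
    have h1 : F.map (rename σ : P →ₐ[ℤ] P).toRingHom = F := by
      simp only [F, Polynomial.map_prod]
      refine Fintype.prod_equiv σ _ _ fun i => ?_
      simp
    conv_rhs => rw [← h1]
    rw [Polynomial.coeff_map]
    rfl
  obtain ⟨f, hf, hfn, hfm⟩ := Polynomial.lifts_and_natDegree_eq_and_monic hFl hFm
  have hesymm : ∀ k : Fin n, (⟨esymm (Fin n) ℤ (k + 1), esymm_isSymmetric _ _ _⟩ : Λ) =
      (-1) ^ (k + 1 : ℕ) * f.coeff (n - (k + 1)) := by
    intro k
    apply Subtype.ext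
    have h1 := coeff_prod_X_sub_C_eq_aeval_esymm
      (fun i => (MvPolynomial.X i : P)) (k := k + 1) (by omega)
    change F.coeff _ = _ at h1
    rw [← hf, Polynomial.coeff_map] at h1
    change esymm (Fin n) ℤ (k + 1) = (-1) ^ (k + 1 : ℕ) * algebraMap Λ P (f.coeff (n - (k + 1)))
    rw [h1, ← mul_assoc, ← mul_pow]
    simp only [neg_mul_neg, one_mul, one_pow]
    exact (MvPolynomial.aeval_X_left_apply (esymm (Fin n) ℤ (k + 1))).symm
  obtain ⟨B, _, _, ι, _, i₀, e, t, he, hft, hadj, huniv⟩ :=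
    hfm.exists_universal_splitting n Λ f (hfn.trans hFn)
  obtain ⟨φ, hφ, hφt⟩ := huniv P (algebraMap Λ P) MvPolynomial.X hf
  let φ' : B →ₐ[Λ] P := { φ with commutes' := fun r => DFunLike.congr_fun hφ r }
  let ψ : P →ₐ[ℤ] B := MvPolynomial.aeval t
  have hψ : ψ.toRingHom.comp (algebraMap Λ P) = algebraMap Λ B := by
    refine symmetricSubalgebra_ringHom_ext fun k => ?_
    conv_rhs => rw [hesymm k]
    have h1 := coeff_prod_X_sub_C_eq_aeval_esymm t (k := k + 1) (by omega)
    rw [← hft, Polynomial.coeff_map] at h1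
    rw [map_mul, h1, map_pow, map_neg, map_one, ← mul_assoc, ← mul_pow]
    simp [ψ]
    rfl
  let ψ' : P →ₐ[Λ] B := { ψ with commutes' := fun r => DFunLike.congr_fun hψ r }
  have h1 : φ'.comp ψ' = AlgHom.id Λ P := by
    have : (φ'.comp ψ').toRingHom = RingHom.id P := by
      refine MvPolynomial.ringHom_ext (fun r => ?_) fun i => ?_
      · simp
      · change φ (ψ (MvPolynomial.X i)) = _
        exact (congrArg φ (MvPolynomial.aeval_X t i)).trans (hφt i)
    ext1 x
    exact DFunLike.congr_fun this x
  have h2 : ψ'.comp φ' = AlgHom.id Λ B := by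
    refine AlgHom.ext_of_adjoin_eq_top hadj ?_
    rintro _ ⟨i, rfl⟩
    change ψ (φ (t i)) = t i
    rw [hφt]
    exact MvPolynomial.aeval_X t i
  exact ⟨ι, inferInstance, i₀, e.map (AlgEquiv.ofAlgHom φ' ψ' h1 h2).toLinearEquiv, by simp [he]⟩

/-- The ring homomorphism from symmetric polynomials to `A` sending the elementary symmetric
polynomials to the signed coefficients of `f`. -/
noncomputable def symmEval {A : Type*} [CommRing A] {n : ℕ} (a : Fin n → A) :
    symmetricSubalgebra (Fin n) ℤ →+* A :=
  (eval₂Hom (Int.castRingHom A) fun k => (-1) ^ (k.1 + 1) * a k).comp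
    (esymmAlgEquiv (Fin n) ℤ (Fintype.card_fin n)).symm.toAlgHom.toRingHom

theorem symmEval_esymm {A : Type*} [CommRing A] {n : ℕ} (a : Fin n → A) (k : Fin n) :
    symmEval a ⟨esymm (Fin n) ℤ (k + 1), esymm_isSymmetric _ _ _⟩ = (-1) ^ (k.1 + 1) * a k := by
  have h := esymmAlgEquiv_symm_apply (σ := Fin n) (R := ℤ) (Fintype.card_fin n) k
  change eval₂Hom (Int.castRingHom A) (fun k : Fin n => (-1) ^ (k.1 + 1) * a k)
    ((esymmAlgEquiv (Fin n) ℤ (Fintype.card_fin n)).symm _) = _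
  rw [h]
  simp

theorem splittingMk_esymm {A : Type*} [CommRing A] {n : ℕ} (a : Fin n → A) (k : Fin n) :
    splittingMk A n a (esymm (Fin n) A (k + 1)) =
      algebraMap A (SplittingAlg A n a) ((-1) ^ (k.1 + 1) * a k) := by
  have h : esymm (Fin n) A (k.1 + 1) - C ((-1 : A) ^ (k.1 + 1) * a k) ∈ splittingIdeal A n a :=
    Ideal.subset_span ⟨k, rfl⟩
  exact Ideal.Quotient.eq.2 h

/-- Evaluation of integral polynomials at the universal roots. -/
noncomputable def tauEval {A : Type*} [CommRing A] {n : ℕ} (a : Fin n → A) :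
    MvPolynomial (Fin n) ℤ →ₐ[ℤ] SplittingAlg A n a :=
  aeval (tau A n a)

theorem tauEval_eq_splittingMk_map {A : Type*} [CommRing A] {n : ℕ} (a : Fin n → A)
    (p : MvPolynomial (Fin n) ℤ) :
    tauEval a p = splittingMk A n a (map (Int.castRingHom A) p) := by
  have h : (tauEval a).toRingHom =
      (splittingMk A n a).toRingHom.comp (map (Int.castRingHom A)) := by
    refine MvPolynomial.ringHom_ext (fun r => by simp) fun i => ?_
    simp [tauEval, tau]
  exact DFunLike.congr_fun h p

theorem tauEval_symmetric {A : Type*} [CommRing A] {n : ℕ} (a : Fin n → A)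
    (p : symmetricSubalgebra (Fin n) ℤ) :
    tauEval a p.1 = algebraMap A (SplittingAlg A n a) (symmEval a p) := by
  have h : (tauEval a).toRingHom.comp
      (algebraMap (symmetricSubalgebra (Fin n) ℤ) (MvPolynomial (Fin n) ℤ)) =
      (algebraMap A (SplittingAlg A n a)).comp (symmEval a) := by
    refine symmetricSubalgebra_ringHom_ext fun k => ?_
    rw [RingHom.comp_apply, RingHom.comp_apply, symmEval_esymm, ← splittingMk_esymm]
    change tauEval a (esymm (Fin n) ℤ (k + 1)) = _
    rw [tauEval_eq_splittingMk_map, map_esymm]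
  exact DFunLike.congr_fun h p

theorem permHom_tauEval {A : Type*} [CommRing A] {n : ℕ} (a : Fin n → A)
    (σ : Equiv.Perm (Fin n)) (p : MvPolynomial (Fin n) ℤ) :
    permHom A n a σ (tauEval a p) = tauEval a (rename σ p) := by
  rw [tauEval_eq_splittingMk_map, tauEval_eq_splittingMk_map, map_rename]
  rfl

theorem exists_algebraMap_eq_of_mem_trivialInv {A : Type*} [CommRing A] {n : ℕ} (a : Fin n → A)
    {x : SplittingAlg A n a} (hx : x ∈ trivialInv A n a ⊤) :
    ∃ c : A, algebraMap A (SplittingAlg A n a) c = x := by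
  obtain ⟨p, hp, rfl⟩ := hx
  obtain ⟨q, hq⟩ := esymmAlgHom_surjective (σ := Fin n) A (Fintype.card_fin n).le
    ⟨p, fun σ => hp σ trivial⟩
  have h : (splittingMk A n a).comp
      ((symmetricSubalgebra (Fin n) A).val.comp (esymmAlgHom (Fin n) A n)) =
      (Algebra.ofId A (SplittingAlg A n a)).comp (aeval fun k => (-1) ^ (k.1 + 1) * a k) := by
    ext k
    simp only [AlgHom.comp_apply, esymmAlgHom, aeval_X]
    exact splittingMk_esymm a k
  have h1 := DFunLike.congr_fun h q
  simp only [AlgHom.comp_apply, hq] at h1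
  exact ⟨_, h1.symm⟩

open TensorProduct in
theorem linearIndependent_tauEval {A : Type*} [CommRing A] {n : ℕ} (a : Fin n → A) {ι : Type*}
    (e : Module.Basis ι (symmetricSubalgebra (Fin n) ℤ) (MvPolynomial (Fin n) ℤ)) :
    LinearIndependent A fun i => tauEval a (e i) := by
  let _ : Algebra (symmetricSubalgebra (Fin n) ℤ) A := (symmEval a).toAlgebra
  let T := A ⊗[symmetricSubalgebra (Fin n) ℤ] MvPolynomial (Fin n) ℤ
  let inc : MvPolynomial (Fin n) ℤ →+* T := Algebra.TensorProduct.includeRight.toRingHom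
  let ev : MvPolynomial (Fin n) A →ₐ[A] T := aeval fun i => inc (X i)
  have hev : ∀ p : MvPolynomial (Fin n) ℤ, ev (map (Int.castRingHom A) p) = inc p := by
    intro p
    have h : ev.toRingHom.comp (map (Int.castRingHom A)) = inc := by
      refine MvPolynomial.ringHom_ext (fun r => by simp) fun i => ?_
      simp [ev]
    exact DFunLike.congr_fun h p
  let φ : SplittingAlg A n a →ₐ[A] T := Ideal.Quotient.liftₐ (splittingIdeal A n a) ev (by
    intro p hp
    have h : splittingIdeal A n a ≤ RingHom.ker ev := by
      refine Ideal.span_le.2 ?_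
      rintro _ ⟨k, rfl⟩
      rw [SetLike.mem_coe, RingHom.mem_ker, map_sub, sub_eq_zero,
        ← map_esymm (σ := Fin n) (n := k.1 + 1) (f := Int.castRingHom A), hev,
        ← algebraMap_eq, AlgHom.commutes, ← symmEval_esymm]
      exact ((Algebra.TensorProduct.includeRight (R := symmetricSubalgebra (Fin n) ℤ)
        (A := A)).commutes ⟨esymm (Fin n) ℤ (k + 1), esymm_isSymmetric _ _ _⟩).trans
        (IsScalarTower.algebraMap_apply _ A T _)
    exact h hp)
  have hφ : ∀ p, φ (tauEval a p) = inc p := by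
    intro p
    rw [tauEval_eq_splittingMk_map, ← hev]
    rfl
  refine LinearIndependent.of_comp φ.toLinearMap ?_
  have h : (φ.toLinearMap ∘ fun i => tauEval a (e i)) = Algebra.TensorProduct.basis A e :=
    funext fun i => (hφ _).trans (Algebra.TensorProduct.basis_apply ..).symm
  rw [h]
  exact (Algebra.TensorProduct.basis A e).linearIndependent

theorem tauEval_eq_sum {A : Type*} [CommRing A] {n : ℕ} (a : Fin n → A) {ι : Type*} [Fintype ι]
    (e : Module.Basis ι (symmetricSubalgebra (Fin n) ℤ) (MvPolynomial (Fin n) ℤ))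
    (p : MvPolynomial (Fin n) ℤ) :
    tauEval a p = ∑ i, symmEval a (e.repr p i) • tauEval a (e i) := by
  conv_lhs => rw [← e.sum_repr p, map_sum]
  refine Finset.sum_congr rfl fun i _ => ?_
  rw [Subalgebra.smul_def, smul_eq_mul, map_mul, tauEval_symmetric]
  exact (Algebra.smul_def _ _).symm

/-- Renaming of variables as a linear map over the symmetric polynomials. -/
noncomputable def renameLinear {n : ℕ} (σ : Equiv.Perm (Fin n)) :
    MvPolynomial (Fin n) ℤ →ₗ[symmetricSubalgebra (Fin n) ℤ] MvPolynomial (Fin n) ℤ where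
  toFun := rename σ
  map_add' := map_add _
  map_smul' p q := by
    rw [Subalgebra.smul_def, smul_eq_mul, map_mul, p.2 σ]
    rfl

/-- `pairSumProd` as an element of the algebra of symmetric polynomials. -/
noncomputable def symmPairSumProd (n : ℕ) : symmetricSubalgebra (Fin n) ℤ :=
  ⟨pairSumProd ℤ n, rename_pairSumProd n⟩

theorem exists_rename_altOrbitSum_sub_eq {n : ℕ} (σ : Equiv.Perm (Fin n)) :
    ∃ p q : MvPolynomial (Fin n) ℤ,
      rename σ (altOrbitSum n) - altOrbitSum n = pairSumProd ℤ n * p + 2 * q := by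
  rcases Int.units_eq_one_or (Equiv.Perm.sign σ) with h | h
  · exact ⟨0, 0, by rw [rename_altOrbitSum_of_sign_eq_one h]; simp⟩
  · obtain ⟨w, hw⟩ : 2 ∣ (Matrix.vandermonde fun i => (X i : MvPolynomial (Fin n) ℤ)).det -
        pairSumProd ℤ n := by
      apply two_dvd_of_map_eq_zero
      rw [map_sub, map_det_vandermonde_eq_pairSumProd, map_pairSumProd, sub_self]
    refine ⟨-1, -w, ?_⟩
    rw [rename_altOrbitSum_of_sign_eq_neg_one h]
    linear_combination -hw

theorem repr_mem_span_symmPairSumProd {n : ℕ} {ι : Type*}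
    (e : Module.Basis ι (symmetricSubalgebra (Fin n) ℤ) (MvPolynomial (Fin n) ℤ))
    {x p q : MvPolynomial (Fin n) ℤ} (h : x = pairSumProd ℤ n * p + 2 * q) (i : ι) :
    e.repr x i ∈ Ideal.span {symmPairSumProd n, 2} := by
  have h1 : x = symmPairSumProd n • p + (2 : symmetricSubalgebra (Fin n) ℤ) • q := by
    rw [h]
    rfl
  rw [h1, map_add, map_smul, map_smul]
  simp only [Finsupp.add_apply, Finsupp.smul_apply, smul_eq_mul]
  exact add_mem (Ideal.mul_mem_right _ _ (Ideal.subset_span (by simp)))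
    (Ideal.mul_mem_right _ _ (Ideal.subset_span (by simp)))

/-- If all nonconstant coordinates of `m * altOrbitSum n` lie in the ideal generated by
`pairSumProd` and `2`, then so does `m`. -/
theorem mem_span_symmPairSumProd {n : ℕ} {ι : Type*} [Fintype ι] {i₀ : ι}
    (e : Module.Basis ι (symmetricSubalgebra (Fin n) ℤ) (MvPolynomial (Fin n) ℤ))
    (he : e i₀ = 1) (m : symmetricSubalgebra (Fin n) ℤ)
    (h : ∀ i, i ≠ i₀ → m * e.repr (altOrbitSum n) i ∈ Ideal.span {symmPairSumProd n, 2}) :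
    m ∈ Ideal.span {symmPairSumProd n, 2} := by
  classical
  have h1 : ∀ i, ∃ u v, i ≠ i₀ →
      u * symmPairSumProd n + v * 2 = m * e.repr (altOrbitSum n) i := by
    intro i
    by_cases hi : i = i₀
    · exact ⟨0, 0, fun h => absurd hi h⟩
    · obtain ⟨u, v, huv⟩ := Ideal.mem_span_pair.1 (h i hi)
      exact ⟨u, v, fun _ => huv⟩
  choose u v huv using h1
  have h2 : m.1 * altOrbitSum n = (m * e.repr (altOrbitSum n) i₀).1 +
      (pairSumProd ℤ n * (∑ i ∈ Finset.univ.erase i₀, (u i).1 * e i) +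
        2 * ∑ i ∈ Finset.univ.erase i₀, (v i).1 * e i) := by
    conv_lhs => rw [← e.sum_repr (altOrbitSum n),
      ← Finset.add_sum_erase _ _ (Finset.mem_univ i₀), he]
    rw [mul_add, Finset.mul_sum, Finset.mul_sum, Finset.mul_sum, ← Finset.sum_add_distrib]
    congr 1
    · rw [Subalgebra.smul_def, smul_eq_mul, mul_one]
      rfl
    · refine Finset.sum_congr rfl fun i hi => ?_
      have h3 := congrArg Subtype.val (huv i (Finset.ne_of_mem_erase hi))
      change (u i).1 * pairSumProd ℤ n + (v i).1 * 2 =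
        m.1 * (e.repr (altOrbitSum n) i).1 at h3
      rw [Subalgebra.smul_def, smul_eq_mul]
      linear_combination (- e i) * h3
  obtain ⟨u', v', hu', hv', hm⟩ := exists_eq_pairSumProd_mul_add m.2 (m * _).2 h2
  refine Ideal.mem_span_pair.2 ⟨⟨u', hu'⟩, ⟨v', hv'⟩, Subtype.ext ?_⟩
  change u' * pairSumProd ℤ n + v' * 2 = m.1
  rw [hm]
  ring

theorem Df_eq_algebraMap {A : Type*} [CommRing A] {n : ℕ} (a : Fin n → A) :
    Df A n a = algebraMap A (SplittingAlg A n a) (symmEval a (symmPairSumProd n)) := by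
  rw [← tauEval_symmetric]
  simp [symmPairSumProd, pairSumProd, Df, tauEval]

/-- If `n ≥ 2` and there is a nonzero `a ∈ A` with `2·a = 0` and
`(algebraMap A A_f a)·D_f = 0`, then there is an `S_n`-invariant element of `A_f` that is not a
trivial `S_n`-invariant. -/
theorem exists_nontrivial_invariant (A : Type*) [CommRing A] (n : ℕ) (hn : 2 ≤ n)
    (a : Fin n → A)
    (hann : ∃ b : A, b ≠ 0 ∧ 2 * b = 0 ∧ algebraMap A (SplittingAlg A n a) b * Df A n a = 0) :
    ∃ x : SplittingAlg A n a, (∀ σ : Equiv.Perm (Fin n), permHom A n a σ x = x) ∧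
      x ∉ trivialInv A n a (⊤ : Subgroup (Equiv.Perm (Fin n))) := by
  classical
  obtain ⟨b, hb, h2b, hDb⟩ := hann
  obtain ⟨ι, _, i₀, e, he⟩ := exists_basis_symmetricSubalgebra n
  have hli := linearIndependent_tauEval a e
  have hD : symmEval a (symmPairSumProd n) * b = 0 := by
    rw [Df_eq_algebraMap, ← map_mul, mul_comm b, Algebra.algebraMap_eq_smul_one] at hDb
    have h1 := Fintype.linearIndependent_iff.1 hli
      (Pi.single i₀ (symmEval a (symmPairSumProd n) * b))
      (by simpa [Pi.single_apply, ite_smul, he] using hDb) i₀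
    simpa using h1
  let κ := {i : ι // i ≠ i₀}
  let M : Matrix (Equiv.Perm (Fin n) × ι) κ (symmetricSubalgebra (Fin n) ℤ) :=
    Matrix.of fun r j => e.repr (rename r.1 (e j) - e j) r.2
  have hMv : ∀ r, M.mulVec (fun j => e.repr (altOrbitSum n) j) r ∈
      Ideal.span {symmPairSumProd n, 2} := by
    rintro ⟨σ, i⟩
    obtain ⟨p, q, hpq⟩ := exists_rename_altOrbitSum_sub_eq σ
    have h1 : rename σ (altOrbitSum n) - altOrbitSum n =
        ∑ j : κ, e.repr (altOrbitSum n) j • (rename σ (e j) - e j) := by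
      have h2 : rename σ (altOrbitSum n) - altOrbitSum n =
          ∑ j, e.repr (altOrbitSum n) j • (rename σ (e j) - e j) := by
        conv_lhs => rw [← e.sum_repr (altOrbitSum n)]
        change renameLinear σ _ - _ = _
        rw [map_sum, ← Finset.sum_sub_distrib]
        refine Finset.sum_congr rfl fun j _ => ?_
        rw [map_smul, ← smul_sub]
        rfl
      rw [h2, ← Finset.add_sum_erase _ _ (Finset.mem_univ i₀), he, map_one, sub_self, smul_zero,
        zero_add]
      exact Finset.sum_subtype (Finset.univ.erase i₀) (by simp) _
    have h2 := repr_mem_span_symmPairSumProd e hpq i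
    rw [h1, map_sum, Finsupp.finsetSum_apply] at h2
    convert h2 using 1
    refine Finset.sum_congr rfl fun j _ => ?_
    rw [map_smul, Finsupp.smul_apply, smul_eq_mul, mul_comm]
    rfl
  have hminor : ∀ (f : Fin (Fintype.card κ) → Equiv.Perm (Fin n) × ι)
      (g : Fin (Fintype.card κ) → κ), b * ((M.map (symmEval a)).submatrix f g).det = 0 := by
    intro f g
    have h1 := mem_span_symmPairSumProd e he (M.submatrix f g).det fun i hi =>
      Matrix.det_submatrix_mul_mem _ M _ hMv f g ⟨i, hi⟩
    obtain ⟨u, v, huv⟩ := Ideal.mem_span_pair.1 h1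
    have h3 : ((M.map (symmEval a)).submatrix f g).det = symmEval a (M.submatrix f g).det := by
      rw [RingHom.map_det]
      rfl
    rw [h3, ← huv, map_add, map_mul, map_mul, map_ofNat]
    linear_combination symmEval a u * hD + symmEval a v * h2b
  obtain ⟨x, hx, hMx⟩ := Matrix.exists_mulVec_eq_zero_of_mul_minors_eq_zero _ hb hminor
  refine ⟨∑ j, x j • tauEval a (e j), fun σ => ?_, fun htriv => hx ?_⟩
  · rw [← sub_eq_zero, map_sum, ← Finset.sum_sub_distrib]
    have h1 : ∀ j : κ, permHom A n a σ (x j • tauEval a (e j)) - x j • tauEval a (e j) =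
        ∑ i, (x j * symmEval a (M (σ, i) j)) • tauEval a (e i) := by
      intro j
      rw [map_smul, permHom_tauEval, ← smul_sub, ← map_sub, tauEval_eq_sum a e, Finset.smul_sum]
      simp only [smul_smul]
      rfl
    simp only [h1]
    rw [Finset.sum_comm]
    refine Finset.sum_eq_zero fun i _ => ?_
    rw [← Finset.sum_smul]
    have h2 := congrFun hMx (σ, i)
    have h3 : ∑ j, x j * symmEval a (M (σ, i) j) = 0 := by
      exact (Finset.sum_congr rfl fun j _ => mul_comm _ _).trans h2
    rw [h3, zero_smul]
  · obtain ⟨c, hc⟩ := exists_algebraMap_eq_of_mem_trivialInv a htriv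
    have h1 : ∑ i, (if h : i ≠ i₀ then x ⟨i, h⟩ else -c) • tauEval a (e i) = 0 := by
      rw [← Finset.add_sum_erase _ _ (Finset.mem_univ i₀), dif_neg (not_not.2 rfl), he, map_one,
        Finset.sum_subtype (p := fun i => i ≠ i₀) (Finset.univ.erase i₀) (by simp), neg_smul,
        neg_add_eq_zero, ← Algebra.algebraMap_eq_smul_one, hc]
      exact Finset.sum_congr rfl fun j _ => by rw [dif_pos j.2]
    ext j
    simpa [j.2] using Fintype.linearIndependent_iff.1 hli _ h1 j
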